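/- (Theorem 1, bound on successive weighted-difference iterates) For every integer k ≥ 1 and every x ∈ S, letting c(x) = T^{k−1}[V₀] x − T^k[V₀] x and ‖c‖_∞ = max_{y∈S} |c y|, one has α·(c(x) − ‖c‖_∞)/(1 − α) ≤ V_{k+1}(x) − V_k(x) ≤ α·(c(x) + ‖c‖_∞)/(1 − α). -/

import Mathlib

open Finset

/-- Discounted Bellman operator `T[V](x) = max_a ∑_y P a x y * (R a x y + α * V y)`. -/
noncomputable def bellman {S A : Type*} [Fintype S] [Fintype A] [Nonempty A]
    (P R : A → S → S → ℝ) (α : ℝ) (V : S → ℝ) : S → ℝ :=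
  fun x => univ.sup' univ_nonempty fun a => ∑ y, P a x y * (R a x y + α * V y)

/-- Undiscounted Bellman operator `T̄[h](x) = max_a ∑_y P a x y * (R a x y + h y)`. -/
noncomputable def ubellman {S A : Type*} [Fintype S] [Fintype A] [Nonempty A]
    (P R : A → S → S → ℝ) (h : S → ℝ) : S → ℝ :=
  fun x => univ.sup' univ_nonempty fun a => ∑ y, P a x y * (R a x y + h y)

/-- Q-function Bellman operator. -/
noncomputable def qbellman {S A : Type*} [Fintype S] [Fintype A] [Nonempty A]
    (P R : A → S → S → ℝ) (α : ℝ) (Q : S → A → ℝ) : S → A → ℝ :=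
  fun x a => ∑ y, P a x y * (R a x y + α * univ.sup' univ_nonempty (Q y))

/-- Span seminorm `‖V‖_d = max V - min V`. -/
noncomputable def spanSeminorm {S : Type*} [Fintype S] [Nonempty S] (V : S → ℝ) : ℝ :=
  univ.sup' univ_nonempty V - univ.inf' univ_nonempty V

/-- Ergodicity assumption: for every sequence of `N` policies and every starting state `x`,
some state `y` is reached after `N` steps with probability at least `ρ`. -/
def ErgodicMDP {S A : Type*} [Fintype S] [DecidableEq S]
    (P : A → S → S → ℝ) (ρ : ℝ) (N : ℕ) : Prop :=
  ∀ μ : Fin N → (S → A), ∀ x : S, ∃ y : S,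
    ρ ≤ (List.ofFn fun i => Matrix.of fun x' y' => P (μ i x') x' y').prod x y

theorem bellman_le_add {S A : Type*} [Fintype S] [Fintype A] [Nonempty A]
    (P R : A → S → S → ℝ)
    (hP0 : ∀ a x y, 0 ≤ P a x y) (hP1 : ∀ a x, ∑ y, P a x y = 1)
    (α : ℝ) (hα0 : 0 < α) (V W : S → ℝ) (M : ℝ) (h : ∀ y, V y ≤ W y + M) (x : S) :
    bellman P R α V x ≤ bellman P R α W x + α * M := by
  unfold bellman
  refine Finset.sup'_le _ _ fun a _ => ?_
  have h1 : ∑ y, P a x y * (R a x y + α * V y)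
      ≤ ∑ y, (P a x y * (R a x y + α * W y) + P a x y * (α * M)) := by
    refine Finset.sum_le_sum fun y _ => ?_
    rw [← mul_add]
    refine mul_le_mul_of_nonneg_left ?_ (hP0 a x y)
    have := mul_le_mul_of_nonneg_left (h y) hα0.le
    linarith
  rw [Finset.sum_add_distrib, ← Finset.sum_mul, hP1, one_mul] at h1
  have h2 := Finset.le_sup' (fun a => ∑ y, P a x y * (R a x y + α * W y)) (Finset.mem_univ a)
  linarith

/-- Theorem 1, bound on successive weighted-difference iterates. -/
theorem stmt_8 {S A : Type*} [Fintype S] [Fintype A] [Nonempty S] [Nonempty A]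
    (P R : A → S → S → ℝ)
    (hP0 : ∀ a x y, 0 ≤ P a x y) (hP1 : ∀ a x, ∑ y, P a x y = 1)
    (α : ℝ) (hα0 : 0 < α) (hα1 : α < 1)
    (V₀ : S → ℝ) :
    ∀ k : ℕ, 1 ≤ k → ∀ x : S,
      α * (((bellman P R α)^[k - 1] V₀ x - (bellman P R α)^[k] V₀ x)
            - univ.sup' univ_nonempty fun y =>
                |(bellman P R α)^[k - 1] V₀ y - (bellman P R α)^[k] V₀ y|) / (1 - α)
          ≤ ((bellman P R α)^[k + 1] V₀ x - α * (bellman P R α)^[k] V₀ x) / (1 - α)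
            - ((bellman P R α)^[k] V₀ x - α * (bellman P R α)^[k - 1] V₀ x) / (1 - α)
        ∧ ((bellman P R α)^[k + 1] V₀ x - α * (bellman P R α)^[k] V₀ x) / (1 - α)
            - ((bellman P R α)^[k] V₀ x - α * (bellman P R α)^[k - 1] V₀ x) / (1 - α)
          ≤ α * (((bellman P R α)^[k - 1] V₀ x - (bellman P R α)^[k] V₀ x)
              + univ.sup' univ_nonempty fun y =>
                  |(bellman P R α)^[k - 1] V₀ y - (bellman P R α)^[k] V₀ y|) / (1 - α) := by
  intro k hk x
  obtain ⟨n, rfl⟩ : ∃ n, k = n + 1 := ⟨k - 1, by omega⟩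
  rw [Nat.add_sub_cancel, Function.iterate_succ_apply' _ (n + 1)]
  set W := (bellman P R α)^[n + 1] V₀ with hW
  have hW' : W = bellman P R α ((bellman P R α)^[n] V₀) := by
    rw [hW, Function.iterate_succ_apply']
  set U := (bellman P R α)^[n] V₀ with hU
  set M := univ.sup' univ_nonempty fun y => |U y - W y| with hM
  have hle : ∀ y, |U y - W y| ≤ M := fun y =>
    Finset.le_sup' (fun y => |U y - W y|) (Finset.mem_univ y)
  have h1 := bellman_le_add P R hP0 hP1 α hα0 U W M
    (fun y => by linarith [(abs_le.mp (hle y)).2]) x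
  have h2 := bellman_le_add P R hP0 hP1 α hα0 W U M
    (fun y => by linarith [(abs_le.mp (hle y)).1]) x
  rw [← hW'] at h1 h2
  have hα : 0 ≤ 1 - α := by linarith
  rw [← sub_div]
  constructor
  · exact div_le_div_of_nonneg_right (by linarith) hα
  · exact div_le_div_of_nonneg_right (by linarith) hα
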